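/- Let T be a finite tree (a connected acyclic simple graph on a finite nonempty vertex set) with adjacency matrix A, in which every vertex has degree at most Δ, and let t be a distinguished vertex. Let λ be a real number with λ > 2√Δ. Then λI − A is invertible, and the quantity α := ([(λI − A)⁻¹]_{t,t})⁻¹ satisfies λ − 2√Δ ≤ α ≤ λ. -/

import Mathlib

open Matrix

theorem parent_unique {V : Type*} (T : SimpleGraph V) (hT : T.IsTree) (t u a b : V)
    (ha : T.Adj u a) (hb : T.Adj u b) (hda : T.dist a t < T.dist u t)
    (hdb : T.dist b t < T.dist u t) : a = b := by
  have key : ∀ a, T.Adj u a → T.dist a t < T.dist u t →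
      ∃ p : T.Walk u t, p.IsPath ∧ p.snd = a := by
    intro a ha hda
    obtain ⟨p, hp⟩ := hT.connected.exists_walk_length_eq_dist a t
    refine ⟨SimpleGraph.Walk.cons ha p, ?_, by simp⟩
    apply SimpleGraph.Walk.isPath_of_length_eq_dist
    have := SimpleGraph.dist_le (SimpleGraph.Walk.cons ha p)
    simp only [SimpleGraph.Walk.length_cons] at this ⊢
    omega
  obtain ⟨p, hp, rfl⟩ := key a ha hda
  obtain ⟨q, hq, rfl⟩ := key b hb hdb
  rw [(hT.existsUnique_path u t).unique hp hq]

theorem quad_bound {V : Type*} [Fintype V] [DecidableEq V]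
    (T : SimpleGraph V) [DecidableRel T.Adj] (hT : T.IsTree)
    (Δ : ℕ) (hdeg : ∀ v : V, T.degree v ≤ Δ) (t : V) (x : V → ℝ) :
    x ⬝ᵥ (T.adjMatrix ℝ *ᵥ x) ≤ 2 * Real.sqrt Δ * (x ⬝ᵥ x) := by
  have hquad : x ⬝ᵥ (T.adjMatrix ℝ *ᵥ x) = ∑ u, ∑ v, if T.Adj u v then x u * x v else 0 := by
    simp only [dotProduct, mulVec, Finset.mul_sum, SimpleGraph.adjMatrix_apply]
    refine Finset.sum_congr rfl fun u _ => Finset.sum_congr rfl fun v _ => ?_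
    split_ifs <;> simp
  rw [hquad]
  rcases Nat.eq_zero_or_pos Δ with h0 | hpos
  · have hno : ∀ u v, ¬ T.Adj u v := by
      intro u v h
      have h1 := hdeg u
      have h2 : 0 < T.degree u := (T.degree_pos_iff_exists_adj u).2 ⟨v, h⟩
      omega
    simp [hno, h0]
  set s := Real.sqrt Δ with hs
  have hs1 : 1 ≤ s := by
    rw [hs, Real.one_le_sqrt]; exact_mod_cast hpos
  have hs0 : 0 < s := by linarith
  have hss : s * s = Δ := Real.mul_self_sqrt (by positivity)
  have hinv : s⁻¹ ≤ 1 := inv_le_one_of_one_le₀ hs1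
  let c : V → V → ℝ := fun u v => if T.dist v t < T.dist u t then s else s⁻¹
  have hrow : ∀ u, ∑ v ∈ T.neighborFinset u, c u v ≤ 2 * s := by
    intro u
    have h1 : ∀ v, c u v = s⁻¹ + if T.dist v t < T.dist u t then s - s⁻¹ else 0 := by
      intro v; simp only [c]; split_ifs <;> ring
    simp only [h1, Finset.sum_add_distrib, Finset.sum_const, ← Finset.sum_filter, nsmul_eq_mul,
      SimpleGraph.card_neighborFinset_eq_degree]
    have hc : ((T.neighborFinset u).filter (fun v => T.dist v t < T.dist u t)).card ≤ 1 := by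
      rw [Finset.card_le_one]
      intro a ha b hb
      simp only [Finset.mem_filter, SimpleGraph.mem_neighborFinset] at ha hb
      exact parent_unique T hT t u a b ha.1 hb.1 ha.2 hb.2
    have hc' : (((T.neighborFinset u).filter (fun v => T.dist v t < T.dist u t)).card : ℝ) ≤ 1 := by
      exact_mod_cast hc
    have hd : (T.degree u : ℝ) ≤ s * s := by rw [hss]; exact_mod_cast hdeg u
    have e1 : (T.degree u : ℝ) * s⁻¹ ≤ s := by
      rw [← div_eq_mul_inv, div_le_iff₀ hs0]; exact hd
    have e2 := mul_le_mul_of_nonneg_right hc' (show 0 ≤ s - s⁻¹ by linarith)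
    have e3 : 0 < s⁻¹ := by positivity
    linarith
  have hterm : ∀ u v, (if T.Adj u v then x u * x v else 0) ≤
      (if T.Adj u v then c u v * x u ^ 2 / 2 else 0) +
      (if T.Adj v u then c v u * x v ^ 2 / 2 else 0) := by
    intro u v
    by_cases h : T.Adj u v
    · have amgm : ∀ a b : ℝ, a * b ≤ s * a ^ 2 / 2 + s⁻¹ * b ^ 2 / 2 := by
        intro a b
        have : s * a ^ 2 / 2 + s⁻¹ * b ^ 2 / 2 - a * b = s⁻¹ * (s * a - b) ^ 2 / 2 := by
          field_simp; ring
        have h2 : 0 ≤ s⁻¹ * (s * a - b) ^ 2 / 2 := by positivity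
        linarith
      simp only [h, h.symm, if_true, c]
      have hne := hT.dist_ne_of_adj t h
      rw [SimpleGraph.dist_comm, SimpleGraph.dist_comm (u := t) (v := v)] at hne
      rcases lt_or_gt_of_ne hne with h3 | h3
      · rw [if_neg (by omega), if_pos h3]
        have := amgm (x v) (x u); linarith
      · rw [if_pos h3, if_neg (by omega)]
        exact amgm (x u) (x v)
    · have h' : ¬ T.Adj v u := fun k => h k.symm
      simp [h, h']
  have hsum : ∑ u, ∑ v, (if T.Adj u v then c u v * x u ^ 2 / 2 else 0) ≤ s * (x ⬝ᵥ x) := by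
    simp only [dotProduct, Finset.mul_sum]
    refine Finset.sum_le_sum fun u _ => ?_
    rw [← Finset.sum_filter, ← SimpleGraph.neighborFinset_eq_filter, ← Finset.sum_div,
      ← Finset.sum_mul]
    have := mul_le_mul_of_nonneg_right (hrow u) (sq_nonneg (x u))
    nlinarith
  calc _ ≤ ∑ u, ∑ v, ((if T.Adj u v then c u v * x u ^ 2 / 2 else 0) +
      (if T.Adj v u then c v u * x v ^ 2 / 2 else 0)) :=
        Finset.sum_le_sum fun u _ => Finset.sum_le_sum fun v _ => hterm u v
    _ = 2 * ∑ u, ∑ v, (if T.Adj u v then c u v * x u ^ 2 / 2 else 0) := by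
        simp only [Finset.sum_add_distrib]
        rw [Finset.sum_comm (f := fun u v => if T.Adj v u then c v u * x v ^ 2 / 2 else 0)]
        ring
    _ ≤ _ := by linarith

/-- for a finite tree `T` of maximum degree at most `Δ` with adjacency
matrix `A`, a distinguished vertex `t`, and a real `λ > 2√Δ`, the matrix `λI - A` is
invertible and `α := ([(λI - A)⁻¹]_{t,t})⁻¹` satisfies `λ - 2√Δ ≤ α ≤ λ`. -/
theorem selfLoop_weight_bounds
    {V : Type*} [Fintype V] [DecidableEq V] [Nonempty V]
    (T : SimpleGraph V) [DecidableRel T.Adj] (hT : T.IsTree)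
    (Δ : ℕ) (hdeg : ∀ v : V, T.degree v ≤ Δ)
    (t : V)
    (A : Matrix V V ℝ) (hA : A = T.adjMatrix ℝ)
    (lam : ℝ) (hlam : 2 * Real.sqrt Δ < lam)
    (α : ℝ) (hα : α = ((lam • (1 : Matrix V V ℝ) - A)⁻¹ t t)⁻¹) :
    IsUnit (lam • (1 : Matrix V V ℝ) - A) ∧
    lam - 2 * Real.sqrt Δ ≤ α ∧ α ≤ lam := by
  have hq : ∀ x : V → ℝ, (lam - 2 * Real.sqrt Δ) * (x ⬝ᵥ x) ≤
      x ⬝ᵥ ((lam • (1 : Matrix V V ℝ) - A) *ᵥ x) := by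
    intro x
    have := quad_bound T hT Δ hdeg t x
    rw [sub_mulVec, smul_mulVec, one_mulVec, dotProduct_sub, dotProduct_smul, smul_eq_mul, hA]
    linarith
  have hsymm : (lam • (1 : Matrix V V ℝ) - A)ᵀ = lam • (1 : Matrix V V ℝ) - A := by
    simp [hA]
  have hMtt : (lam • (1 : Matrix V V ℝ) - A) t t = lam := by simp [hA]
  set M := lam • (1 : Matrix V V ℝ) - A with hM
  have hpos : 0 < lam - 2 * Real.sqrt Δ := by linarith
  have hlam0 : 0 < lam := by have := Real.sqrt_nonneg (Δ : ℝ); linarith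
  have hU : IsUnit M := by
    rw [← mulVec_injective_iff_isUnit]
    intro a b hab
    have h0 : M *ᵥ (a - b) = 0 := by rw [mulVec_sub]; exact sub_eq_zero.2 hab
    have h1 := hq (a - b)
    rw [h0, dotProduct_zero] at h1
    have h2 : 0 ≤ (a - b) ⬝ᵥ (a - b) := Finset.sum_nonneg fun i _ => mul_self_nonneg _
    have h3 : (a - b) ⬝ᵥ (a - b) = 0 := by nlinarith
    exact sub_eq_zero.1 (dotProduct_self_eq_zero.1 h3)
  refine ⟨hU, ?_⟩
  have hdet : IsUnit M.det := (Matrix.isUnit_iff_isUnit_det _).1 hU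
  set g := M⁻¹ t t with hg
  let e : V → ℝ := Pi.single t 1
  let y : V → ℝ := M⁻¹ *ᵥ e
  have hMy : M *ᵥ y = e := by
    simp only [y, mulVec_mulVec, Matrix.mul_nonsing_inv _ hdet, one_mulVec]
  have hyt : y t = g := by simp [y, e, hg]
  have hye : y ⬝ᵥ e = g := by simp [e, hyt]
  have hey : e ⬝ᵥ e = 1 := by simp [e]
  have hyMe : y ⬝ᵥ (M *ᵥ e) = 1 := by
    rw [dotProduct_mulVec, ← mulVec_transpose, hsymm, hMy, hey]
  have heMe : e ⬝ᵥ (M *ᵥ e) = lam := by simp [e, hMtt]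
  have hyy : g ^ 2 ≤ y ⬝ᵥ y := by
    rw [← hyt, sq]
    exact Finset.single_le_sum (f := fun i => y i * y i) (fun i _ => mul_self_nonneg _)
      (Finset.mem_univ t)
  have h1 := hq y
  rw [hMy, hye] at h1
  have h2 := hq (y - lam⁻¹ • e)
  have h2' : 0 ≤ (y - lam⁻¹ • e) ⬝ᵥ (y - lam⁻¹ • e) :=
    Finset.sum_nonneg fun i _ => mul_self_nonneg _
  have h3 : (y - lam⁻¹ • e) ⬝ᵥ (M *ᵥ (y - lam⁻¹ • e)) = g - lam⁻¹ := by
    simp only [mulVec_sub, mulVec_smul, sub_dotProduct, dotProduct_sub, smul_dotProduct,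
      dotProduct_smul, smul_eq_mul, hMy, hye, hey, hyMe, heMe]
    field_simp
    ring
  have h4 : lam⁻¹ ≤ g := by
    have := mul_nonneg hpos.le h2'
    linarith
  have hli : 0 < lam⁻¹ := by positivity
  have hg0 : 0 < g := by linarith
  rw [hα]
  constructor
  · rw [← one_div, le_div_iff₀ hg0]
    have h5 := mul_le_mul_of_nonneg_left hyy hpos.le
    have h6 : ((lam - 2 * Real.sqrt Δ) * g) * g ≤ 1 * g := by nlinarith
    exact le_of_mul_le_mul_right h6 hg0
  · exact inv_le_of_inv_le₀ hlam0 h4
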